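/- For a weakly C(4) finite monoid presentation ⟨A | R⟩: suppose u = X·Y·u′ where XY is a clean overlap prefix of u (XYZ a relation word with maximal piece prefix X, middle word Y, maximal piece suffix Z). Then u ≡ v if and only if one of the following mutually exclusive conditions holds: (1) u = XYZ·u″, v = XYZ·v″, and Z̄·u″ ≡ Z̄·v″ for some complement Z̄ of Z; (2) u = XY·u′, v = XY·v′, Z fails to be a prefix of at least one of u′ and v′, and u′ ≡ v′; (3) u = XYZ·u″, v = X̄·Ȳ·Z̄·v″ for some uniquely determined proper complement X̄ȲZ̄ of XYZ, and Ẑ·u″ ≡ Ẑ·v″ for some complement Ẑ of Z; (4) u = XY·u′, v = X̄·Ȳ·Z̄·v″ for some uniquely determined proper complement X̄ȲZ̄ of XYZ, Z is not a prefix of u′, and u′ ≡ Z·v″; (5) u = XYZ·u″, v = X̄·Ȳ·v′ for some uniquely determined proper complement X̄ȲZ̄ of XYZ, Z̄ is not a prefix of v′, and Z̄·u″ ≡ v′; (6) u = XY·u′, v = X̄·Ȳ·v′ for some uniquely determined proper complement X̄ȲZ̄ of XYZ, Z is not a prefix of u′, Z̄ is not a prefix of v′, and writing z for the maximal common suffix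 of Z and Z̄ with Z = z₁·z and Z̄ = z₂·z, we have u′ = z₁·u″, v′ = z₂·v″, u″ ≡ v″, z is nonempty, and z is a possible prefix of u″. -/

import Mathlib

open List

/-- A *relation word* is a word occurring as one side of some relation in `R`. -/
def RelWord {A : Type*} (R : Finset (List A × List A)) (w : List A) : Prop :=
  ∃ p ∈ R, w = p.1 ∨ w = p.2

/-- One elementary rewriting step using a defining relation (in either direction). -/
def OneStep {A : Type*} (R : Finset (List A × List A)) (u v : List A) : Prop :=
  ∃ l r x y, ((x, y) ∈ R ∨ (y, x) ∈ R) ∧ u = l ++ x ++ r ∧ v = l ++ y ++ r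

/-- `u ≡ v`: the congruence on the free monoid `A*` generated by the relations `R`. -/
def MEquiv {A : Type*} (R : Finset (List A × List A)) : List A → List A → Prop :=
  Relation.ReflTransGen (OneStep R)

/-- A *piece*: a word occurring as a factor of two distinct relation words, or in two
different (possibly overlapping) positions within one relation word.  The empty word
is a piece. -/
def Piece {A : Type*} (R : Finset (List A × List A)) (p : List A) : Prop :=
  p = [] ∨ ∃ r₁ r₂ a₁ b₁ a₂ b₂, RelWord R r₁ ∧ RelWord R r₂ ∧
    r₁ = a₁ ++ p ++ b₁ ∧ r₂ = a₂ ++ p ++ b₂ ∧ (r₁ ≠ r₂ ∨ a₁ ≠ a₂)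

/-- Weakly `C(n)`: no relation word is a product of strictly fewer than `n` pieces. -/
def WeaklyC {A : Type*} (R : Finset (List A × List A)) (n : ℕ) : Prop :=
  ∀ w, RelWord R w → ∀ L : List (List A), (∀ p ∈ L, Piece R p) → w = L.flatten →
    n ≤ L.length

/-- `X` is the maximal (longest) prefix of `r` which is a piece. -/
def MaxPiecePrefix {A : Type*} (R : Finset (List A × List A)) (r X : List A) : Prop :=
  X <+: r ∧ Piece R X ∧ ∀ p, p <+: r → Piece R p → p.length ≤ X.length

/-- `Z` is the maximal (longest) suffix of `r` which is a piece. -/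
def MaxPieceSuffix {A : Type*} (R : Finset (List A × List A)) (r Z : List A) : Prop :=
  Z <:+ r ∧ Piece R Z ∧ ∀ s, s <:+ r → Piece R s → s.length ≤ Z.length

/-- `X ++ Y ++ Z` is a relation word with maximal piece prefix `X`, middle word `Y`
and maximal piece suffix `Z`. -/
def RelDecomp {A : Type*} (R : Finset (List A × List A)) (X Y Z : List A) : Prop :=
  RelWord R (X ++ Y ++ Z) ∧ MaxPiecePrefix R (X ++ Y ++ Z) X ∧
    MaxPieceSuffix R (X ++ Y ++ Z) Z

/-- `q` is a relation prefix of `u`: a prefix of the form `a ++ X ++ Y` where `X`, `Y`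
are the maximal piece prefix and middle word of some relation word `X ++ Y ++ Z`. -/
def RelPrefix {A : Type*} (R : Finset (List A × List A)) (u q : List A) : Prop :=
  q <+: u ∧ ∃ a X Y Z, q = a ++ X ++ Y ∧ RelDecomp R X Y Z

/-- `a ++ X ++ Y` is an overlap prefix of `u`, with final maximal piece prefix `X` and
middle word `Y`, i.e. it admits a factorisation `b X₁ Y₁' ⋯ X_{n-1} Y_{n-1}' X_n Y_n`
with `X = X_n`, `Y = Y_n`, no factor `X₀ Y₀` beginning strictly before the end of `b`,
each `X_i Y_i Z_i` a relation word factored into maximal piece prefix, middle word and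
maximal piece suffix, and each `Y_i'` (`i < n`) a proper non-empty prefix of `Y_i`. -/
def OPrefix {A : Type*} (R : Finset (List A × List A)) (u a X Y : List A) : Prop :=
  (a ++ X ++ Y) <+: u ∧
  ∃ (b : List A) (n : ℕ) (Xs Ys Zs Ys' : ℕ → List A),
    1 ≤ n ∧ Xs (n - 1) = X ∧ Ys (n - 1) = Y ∧
    a = b ++ ((List.range (n - 1)).map fun i => Xs i ++ Ys' i).flatten ∧
    (∀ i < n, RelDecomp R (Xs i) (Ys i) (Zs i)) ∧
    (∀ i < n - 1, Ys' i ≠ [] ∧ Ys' i <+: Ys i ∧ Ys' i ≠ Ys i) ∧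
    ¬ ∃ c d X₀ Y₀ Z₀, RelDecomp R X₀ Y₀ Z₀ ∧
        a ++ X ++ Y = c ++ X₀ ++ Y₀ ++ d ∧ c.length < b.length

/-- The relation prefix `a ++ X ++ Y` of `u` is *clean*: `u` has no prefix
`a ++ X ++ Y₀ ++ X₁ ++ Y₁` with `Y₀` a proper non-empty prefix of `Y` and `X₁`, `Y₁`
the maximal piece prefix and middle word of some relation word. -/
def CleanAt {A : Type*} (R : Finset (List A × List A)) (u a X Y : List A) : Prop :=
  ¬ ∃ Y₀ X₁ Y₁ Z₁, RelDecomp R X₁ Y₁ Z₁ ∧ Y₀ ≠ [] ∧ Y₀ <+: Y ∧ Y₀ ≠ Y ∧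
      (a ++ X ++ Y₀ ++ X₁ ++ Y₁) <+: u

/-- `a ++ X ++ Y` is a clean overlap prefix of `u`, where `X ++ Y ++ Z` is a relation
word with maximal piece prefix `X`, middle word `Y` and maximal piece suffix `Z`. -/
def CleanOverlapPrefix {A : Type*} (R : Finset (List A × List A))
    (u a X Y Z : List A) : Prop :=
  RelDecomp R X Y Z ∧ OPrefix R u a X Y ∧ CleanAt R u a X Y

/-- `r'` is a complement of the relation word `r`: there is a chain of relation words
from `r` to `r'` each consecutive pair of which forms a relation (in some order). -/
def RelComplement {A : Type*} (R : Finset (List A × List A)) (r r' : List A) : Prop :=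
  RelWord R r ∧ Relation.ReflTransGen (fun s t => (s, t) ∈ R ∨ (t, s) ∈ R) r r'

/-- `u` is `p`-active: `p ++ u` has a relation prefix `a ++ X ++ Y` with `|a| < |p|`. -/
def PActive {A : Type*} (R : Finset (List A × List A)) (p u : List A) : Prop :=
  ∃ a X Y Z, RelDecomp R X Y Z ∧ (a ++ X ++ Y) <+: (p ++ u) ∧ a.length < p.length

/-- `p` is a possible prefix of `u`: `p ++ w ≡ u` for some word `w`. -/
def PossPrefix {A : Type*} (R : Finset (List A × List A)) (p u : List A) : Prop :=
  ∃ w, MEquiv R (p ++ w) u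

/-- `Z'` is a complement of `Z` (relative to the relation word `X ++ Y ++ Z`): it is
the maximal piece suffix of some complement `X' ++ Y' ++ Z'` of `X ++ Y ++ Z`. -/
def ZComp {A : Type*} (R : Finset (List A × List A)) (X Y Z Z' : List A) : Prop :=
  ∃ X' Y', RelComplement R (X ++ Y ++ Z) (X' ++ Y' ++ Z') ∧ RelDecomp R X' Y' Z'

/-- `X' ++ Y' ++ Z'` is a *proper* complement of the relation word `r`. -/
def ProperComp {A : Type*} (R : Finset (List A × List A)) (r X' Y' Z' : List A) :
    Prop :=
  RelComplement R r (X' ++ Y' ++ Z') ∧ RelDecomp R X' Y' Z' ∧ X' ++ Y' ++ Z' ≠ r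

/-- `X' ++ Y' ++ Z'` is the *uniquely determined* proper complement of `r` whose
prefix `X' ++ Y'` is a prefix of `v`. -/
def UniqueComp {A : Type*} (R : Finset (List A × List A)) (r v X' Y' Z' : List A) :
    Prop :=
  ∀ X'' Y'' Z'', ProperComp R r X'' Y'' Z'' → (X'' ++ Y'') <+: v →
    X'' = X' ∧ Y'' = Y' ∧ Z'' = Z'

/-- Condition (1): `u = XYZu''`, `v = XYZv''` and `Z̄u'' ≡ Z̄v''` for some complement
`Z̄` of `Z`. -/
def Cond1 {A : Type*} (R : Finset (List A × List A)) (X Y Z u' v : List A) : Prop :=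
  ∃ u'' v'', u' = Z ++ u'' ∧ v = X ++ Y ++ Z ++ v'' ∧
    ∃ Z', ZComp R X Y Z Z' ∧ MEquiv R (Z' ++ u'') (Z' ++ v'')

/-- Condition (2): `u = XYu'`, `v = XYv'`, `Z` fails to be a prefix of at least one of
`u'` and `v'`, and `u' ≡ v'`. -/
def Cond2 {A : Type*} (R : Finset (List A × List A)) (X Y Z u' v : List A) : Prop :=
  ∃ v', v = X ++ Y ++ v' ∧ (¬ Z <+: u' ∨ ¬ Z <+: v') ∧ MEquiv R u' v'

/-- Condition (3): `u = XYZu''`, `v = X̄ȲZ̄v''` for a uniquely determined proper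
complement `X̄ȲZ̄` of `XYZ`, and `Ẑu'' ≡ Ẑv''` for some complement `Ẑ` of `Z`. -/
def Cond3 {A : Type*} (R : Finset (List A × List A)) (X Y Z u' v : List A) : Prop :=
  ∃ X' Y' Z' u'' v'', u' = Z ++ u'' ∧ ProperComp R (X ++ Y ++ Z) X' Y' Z' ∧
    v = X' ++ Y' ++ Z' ++ v'' ∧ UniqueComp R (X ++ Y ++ Z) v X' Y' Z' ∧
    ∃ Zh, ZComp R X Y Z Zh ∧ MEquiv R (Zh ++ u'') (Zh ++ v'')

/-- Condition (4): `u = XYu'`, `v = X̄ȲZ̄v''` for a uniquely determined proper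
complement, `Z` is not a prefix of `u'`, and `u' ≡ Zv''`. -/
def Cond4 {A : Type*} (R : Finset (List A × List A)) (X Y Z u' v : List A) : Prop :=
  ∃ X' Y' Z' v'', ProperComp R (X ++ Y ++ Z) X' Y' Z' ∧
    v = X' ++ Y' ++ Z' ++ v'' ∧ UniqueComp R (X ++ Y ++ Z) v X' Y' Z' ∧
    ¬ Z <+: u' ∧ MEquiv R u' (Z ++ v'')

/-- Condition (5): `u = XYZu''`, `v = X̄Ȳv'` for a uniquely determined proper
complement, `Z̄` is not a prefix of `v'`, and `Z̄u'' ≡ v'`. -/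
def Cond5 {A : Type*} (R : Finset (List A × List A)) (X Y Z u' v : List A) : Prop :=
  ∃ X' Y' Z' u'' v', u' = Z ++ u'' ∧ ProperComp R (X ++ Y ++ Z) X' Y' Z' ∧
    v = X' ++ Y' ++ v' ∧ UniqueComp R (X ++ Y ++ Z) v X' Y' Z' ∧
    ¬ Z' <+: v' ∧ MEquiv R (Z' ++ u'') v'

/-- Condition (6): `u = XYu'`, `v = X̄Ȳv'` for a uniquely determined proper
complement, `Z` is not a prefix of `u'`, `Z̄` is not a prefix of `v'`, and with `z`
the maximal common suffix of `Z` and `Z̄`, `Z = z₁z`, `Z̄ = z₂z`, `u' = z₁u''`,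
`v' = z₂v''`, `u'' ≡ v''`, `z` is non-empty and `z` is a possible prefix of `u''`. -/
def Cond6 {A : Type*} (R : Finset (List A × List A)) (X Y Z u' v : List A) : Prop :=
  ∃ X' Y' Z' v', ProperComp R (X ++ Y ++ Z) X' Y' Z' ∧ v = X' ++ Y' ++ v' ∧
    UniqueComp R (X ++ Y ++ Z) v X' Y' Z' ∧ ¬ Z <+: u' ∧ ¬ Z' <+: v' ∧
    ∃ z z₁ z₂ u'' v'', Z = z₁ ++ z ∧ Z' = z₂ ++ z ∧
      (∀ w, w <:+ Z → w <:+ Z' → w.length ≤ z.length) ∧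
      u' = z₁ ++ u'' ∧ v' = z₂ ++ v'' ∧ MEquiv R u'' v'' ∧ z ≠ [] ∧
      PossPrefix R z u''

section Words

variable {A : Type*} {R : Finset (List A × List A)}

/-- A property of words of bounded length has a longest witness. -/
theorem exists_longest_of_bounded (P : List A → Prop) (h : P []) (N : ℕ)
    (hN : ∀ l, P l → l.length ≤ N) : ∃ l, P l ∧ ∀ m, P m → m.length ≤ l.length := by
  classical
  obtain ⟨l, hl, hlen⟩ := Nat.findGreatest_spec (P := fun k => ∃ l, P l ∧ l.length = k)
    (Nat.zero_le N) ⟨[], h, rfl⟩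
  refine ⟨l, hl, fun m hm => ?_⟩
  rw [hlen]
  exact Nat.le_findGreatest (hN m hm) ⟨m, hm, rfl⟩

theorem exists_max_common_suffix (s t : List A) :
    ∃ z s₁ t₁, s = s₁ ++ z ∧ t = t₁ ++ z ∧
      ∀ w, w <:+ s → w <:+ t → w.length ≤ z.length := by
  obtain ⟨z, ⟨⟨s₁, h₁⟩, ⟨t₁, h₂⟩⟩, hz⟩ :=
    exists_longest_of_bounded (fun w => w <:+ s ∧ w <:+ t)
      ⟨List.nil_suffix, List.nil_suffix⟩ s.length (fun l hl => hl.1.length_le)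
  exact ⟨z, s₁, t₁, h₁.symm, h₂.symm, fun w hs ht => hz w ⟨hs, ht⟩⟩

/-! ### The congruence -/

theorem OneStep.symm {u v : List A} (h : OneStep R u v) : OneStep R v u := by
  obtain ⟨l, r, x, y, h, hu, hv⟩ := h
  exact ⟨l, r, y, x, h.symm, hv, hu⟩

theorem OneStep.append_left {u v : List A} (a : List A) (h : OneStep R u v) :
    OneStep R (a ++ u) (a ++ v) := by
  obtain ⟨l, r, x, y, h, rfl, rfl⟩ := h
  exact ⟨a ++ l, r, x, y, h, by simp, by simp⟩

theorem OneStep.append_right {u v : List A} (b : List A) (h : OneStep R u v) :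
    OneStep R (u ++ b) (v ++ b) := by
  obtain ⟨l, r, x, y, h, rfl, rfl⟩ := h
  exact ⟨l, r ++ b, x, y, h, by simp, by simp⟩

theorem MEquiv.refl (u : List A) : MEquiv R u u := Relation.ReflTransGen.refl

theorem MEquiv.symm {u v : List A} (h : MEquiv R u v) : MEquiv R v u := by
  induction h with
  | refl => exact MEquiv.refl _
  | tail _ h ih => exact ih.head h.symm

theorem MEquiv.trans {u v w : List A} (h : MEquiv R u v) (h' : MEquiv R v w) :
    MEquiv R u w := Relation.ReflTransGen.trans h h'

theorem MEquiv.append_left {u v : List A} (a : List A) (h : MEquiv R u v) :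
    MEquiv R (a ++ u) (a ++ v) := by
  induction h with
  | refl => exact MEquiv.refl _
  | tail _ h ih => exact ih.tail (h.append_left a)

theorem MEquiv.append_right {u v : List A} (b : List A) (h : MEquiv R u v) :
    MEquiv R (u ++ b) (v ++ b) := by
  induction h with
  | refl => exact MEquiv.refl _
  | tail _ h ih => exact ih.tail (h.append_right b)

/-- `v` is obtained from `u` by exactly `n` elementary rewriting steps. -/
def NStep {A : Type*} (R : Finset (List A × List A)) : ℕ → List A → List A → Prop
  | 0, u, v => u = v
  | n + 1, u, v => ∃ w, NStep R n u w ∧ OneStep R w v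

theorem NStep.mequiv {n : ℕ} {u v : List A} (h : NStep R n u v) : MEquiv R u v := by
  induction n generalizing v with
  | zero => cases h; exact MEquiv.refl _
  | succ n ih =>
    obtain ⟨w, h, h'⟩ := h
    exact (ih h).tail h'

theorem MEquiv.exists_nStep {u v : List A} (h : MEquiv R u v) : ∃ n, NStep R n u v := by
  induction h with
  | refl => exact ⟨0, rfl⟩
  | tail _ h ih =>
    obtain ⟨n, ih⟩ := ih
    exact ⟨n + 1, _, ih, h⟩

theorem NStep.cons_left {n : ℕ} {c : A} {s t : List A} (h : NStep R n (c :: s) t) :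
    (∃ t', t = c :: t' ∧ NStep R n s t') ∨
      ∃ r e i j, RelWord R r ∧ i ≤ n ∧ j ≤ n ∧ NStep R i (c :: s) (r ++ e) ∧
        NStep R j (r ++ e) t := by
  induction n generalizing t with
  | zero => cases h; exact Or.inl ⟨s, rfl, rfl⟩
  | succ n ih =>
    obtain ⟨w, h, hs⟩ := h
    rcases ih h with ⟨w', rfl, hw⟩ | ⟨r, e, i, j, hr, hi, hj, h₁, h₂⟩
    · obtain ⟨l, r, x, y, hxy, hl, rfl⟩ := hs
      rcases l with _ | ⟨d, l⟩
      · right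
        refine ⟨x, r, n, 1, ?_, by omega, by omega, ?_, _, rfl, [], r, x, y, hxy, ?_, ?_⟩
        · rcases hxy with hxy | hxy
          · exact ⟨_, hxy, Or.inl rfl⟩
          · exact ⟨_, hxy, Or.inr rfl⟩
        · rw [hl] at h; simpa using h
        · simp
        · simp
      · left
        simp only [List.cons_append, List.cons.injEq] at hl
        obtain ⟨rfl, rfl⟩ := hl
        exact ⟨l ++ y ++ r, by simp, _, hw, l, r, x, y, hxy, rfl, rfl⟩
    · exact Or.inr ⟨r, e, i, j + 1, hr, by omega, by omega, h₁, w, h₂, hs⟩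

/-- Along a rewriting sequence, either the first `k` letters are never touched, or the
sequence fixes a shorter prefix immediately after which a relation word appears. -/
theorem NStep.split {n : ℕ} {s t : List A} (h : NStep R n s t) (k : ℕ) (hk : k ≤ s.length) :
    ∃ a s' t', s = a ++ s' ∧ t = a ++ t' ∧
      ((a.length = k ∧ NStep R n s' t') ∨
        (a.length < k ∧ ∃ r e i j, RelWord R r ∧ i ≤ n ∧ j ≤ n ∧ NStep R i s' (r ++ e) ∧
          NStep R j (r ++ e) t')) := by
  induction k with
  | zero => exact ⟨[], s, t, rfl, rfl, Or.inl ⟨rfl, h⟩⟩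
  | succ k ih =>
    obtain ⟨a, s', t', rfl, rfl, ⟨ha, h'⟩ | ⟨ha, hr⟩⟩ := ih (by omega)
    · rcases s' with _ | ⟨c, s'⟩
      · simp at hk; omega
      · rcases h'.cons_left with ⟨t', rfl, h''⟩ | h''
        · exact ⟨a ++ [c], s', t', by simp, by simp, Or.inl ⟨by simp [ha], h''⟩⟩
        · exact ⟨a, c :: s', t', rfl, rfl, Or.inr ⟨by omega, h''⟩⟩
    · exact ⟨a, s', t', rfl, rfl, Or.inr ⟨by omega, hr⟩⟩

/-! ### Pieces and factorisations of relation words -/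

theorem Piece.of_factor {p q : List A} (h : Piece R p) (hq : q <:+: p) : Piece R q := by
  obtain ⟨s, t, rfl⟩ := hq
  rcases h with h | ⟨r₁, r₂, a₁, b₁, a₂, b₂, h₁, h₂, e₁, e₂, h⟩
  · left; simp at h; exact h.2.1
  · right
    refine ⟨r₁, r₂, a₁ ++ s, t ++ b₁, a₂ ++ s, t ++ b₂, h₁, h₂, ?_, ?_, ?_⟩
    · simpa using e₁
    · simpa using e₂
    · simpa using h

theorem exists_relDecomp (hC : WeaklyC R 4) {r : List A} (hr : RelWord R r) :
    ∃ X Y Z, r = X ++ Y ++ Z ∧ RelDecomp R X Y Z := by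
  obtain ⟨X, ⟨⟨W, hXr⟩, hX⟩, hXm⟩ :=
    exists_longest_of_bounded (fun p => p <+: r ∧ Piece R p)
      ⟨⟨r, rfl⟩, Or.inl rfl⟩ r.length (fun l hl => hl.1.length_le)
  obtain ⟨Z, ⟨⟨V, hZr⟩, hZ⟩, hZm⟩ :=
    exists_longest_of_bounded (fun p => p <:+ r ∧ Piece R p)
      ⟨List.nil_suffix, Or.inl rfl⟩ r.length (fun l hl => hl.1.length_le)
  have key : ∃ Y, V = X ++ Y := by
    rcases List.append_eq_append_iff.1 (hZr.trans hXr.symm) with ⟨c, hc, hd⟩ | ⟨c, hc, -⟩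
    · have := hC r hr [X, W] (by
        intro p hp
        simp only [List.mem_cons, List.not_mem_nil, or_false] at hp
        rcases hp with rfl | rfl
        · exact hX
        · exact hZ.of_factor ⟨c, [], by simp [hd]⟩) (by simp [hXr])
      simp at this
    · exact ⟨c, hc⟩
  obtain ⟨Y, rfl⟩ := key
  subst hZr
  exact ⟨X, Y, Z, rfl, hr, ⟨⟨W, hXr⟩, hX, fun p h h' => hXm p ⟨h, h'⟩⟩,
    ⟨_, rfl⟩, hZ, fun p h h' => hZm p ⟨h, h'⟩⟩

section Decomp

variable {X Y Z X₁ Y₁ Z₁ X₂ Y₂ Z₂ : List A}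

theorem RelDecomp.middle_not_piece (hC : WeaklyC R 4) (h : RelDecomp R X Y Z) :
    ¬ Piece R Y := by
  intro hY
  have := hC _ h.1 [X, Y, Z] (by
    intro p hp
    simp only [List.mem_cons, List.not_mem_nil, or_false] at hp
    rcases hp with rfl | rfl | rfl
    exacts [h.2.1.2.1, hY, h.2.2.2.1]) (by simp)
  simp at this

/-- A middle word occurs in relation words only at its own position. -/
theorem RelDecomp.eq_of_middle (hC : WeaklyC R 4) (h : RelDecomp R X Y Z) {a b : List A}
    (hr : RelWord R (a ++ (Y ++ b))) : a = X ∧ b = Z := by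
  by_cases hc : X ++ Y ++ Z = a ++ (Y ++ b) ∧ X = a
  · obtain ⟨he, rfl⟩ := hc
    simp at he
    exact ⟨rfl, he.symm⟩
  · exact absurd (Or.inr ⟨_, _, X, Z, a, b, h.1, hr, rfl, by simp, by tauto⟩)
      (h.middle_not_piece hC)

theorem RelDecomp.eq_nil_of_relWord (hC : WeaklyC R 4) (h : RelDecomp R X Y Z)
    {a b : List A} (hr : RelWord R (a ++ (X ++ (Y ++ b)))) : a = [] := by
  have := (h.eq_of_middle hC (a := a ++ X) (b := b) (by simpa using hr)).1
  simpa using this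

theorem RelDecomp.unique (h₁ : RelDecomp R X₁ Y₁ Z₁) (h₂ : RelDecomp R X₂ Y₂ Z₂)
    (h : X₁ ++ Y₁ ++ Z₁ = X₂ ++ Y₂ ++ Z₂) : X₁ = X₂ ∧ Y₁ = Y₂ ∧ Z₁ = Z₂ := by
  obtain ⟨-, ⟨p₁, p₁', p₁''⟩, ⟨s₁, s₁', s₁''⟩⟩ := h₁
  obtain ⟨-, ⟨p₂, p₂', p₂''⟩, ⟨s₂, s₂', s₂''⟩⟩ := h₂
  rw [← h] at p₂ p₂'' s₂ s₂''
  have hX : X₁ = X₂ := (List.prefix_of_prefix_length_le p₁ p₂ (p₂'' _ p₁ p₁')).eq_of_length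
    (le_antisymm (p₂'' _ p₁ p₁') (p₁'' _ p₂ p₂'))
  have hZ : Z₁ = Z₂ := (List.suffix_of_suffix_length_le s₁ s₂ (s₂'' _ s₁ s₁')).eq_of_length
    (le_antisymm (s₂'' _ s₁ s₁') (s₁'' _ s₂ s₂'))
  subst hX hZ
  simpa using h

/-- Two occurrences of (a suffix of a maximal piece prefix followed by) a middle word at
the same place belong to the same relation word. -/
theorem RelDecomp.overlap_unique (hC : WeaklyC R 4) {p s q t c d : List A}
    (h₁ : RelDecomp R (p ++ s) Y₁ Z₁) (h₂ : RelDecomp R (q ++ t) Y₂ Z₂)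
    (h : s ++ (Y₁ ++ c) = t ++ (Y₂ ++ d)) : p = q ∧ s = t ∧ Y₁ = Y₂ ∧ Z₁ = Z₂ := by
  have aux : ∀ {p s q t Y₁ Y₂ Z₁ Z₂ e : List A}, RelDecomp R (p ++ s) Y₁ Z₁ →
      RelDecomp R (q ++ t) Y₂ Z₂ → t ++ Y₂ = s ++ Y₁ ++ e →
      p = q ∧ s = t ∧ Y₁ = Y₂ ∧ Z₁ = Z₂ := by
    intro p s q t Y₁ Y₂ Z₁ Z₂ e h₁ h₂ he
    have hw : q ++ t ++ Y₂ ++ Z₂ = q ++ s ++ (Y₁ ++ (e ++ Z₂)) := by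
      have := congrArg (fun l => q ++ (l ++ Z₂)) he
      simpa using this
    obtain ⟨e₁, e₂⟩ := h₁.eq_of_middle hC (a := q ++ s) (b := e ++ Z₂) (hw ▸ h₂.1)
    have hpq : q = p := by simpa using e₁
    subst hpq
    rw [e₂] at hw
    have := h₁.unique h₂ (by rw [hw]; simp)
    simpa using this
  rw [← List.append_assoc, ← List.append_assoc] at h
  rcases List.append_eq_append_iff.1 h with ⟨e, he, -⟩ | ⟨e, he, -⟩
  · exact aux h₁ h₂ he
  · obtain ⟨h₁, h₂, h₃, h₄⟩ := aux h₂ h₁ he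
    exact ⟨h₁.symm, h₂.symm, h₃.symm, h₄.symm⟩

theorem RelDecomp.prefix_unique (hC : WeaklyC R 4) {c d : List A}
    (h₁ : RelDecomp R X₁ Y₁ Z₁) (h₂ : RelDecomp R X₂ Y₂ Z₂)
    (h : X₁ ++ (Y₁ ++ c) = X₂ ++ (Y₂ ++ d)) : X₁ = X₂ ∧ Y₁ = Y₂ ∧ Z₁ = Z₂ :=
  (RelDecomp.overlap_unique hC (p := []) (q := []) h₁ h₂ h).2

/-- A relation prefix occurring in a word which starts with another one begins either at
the very start, or strictly inside or after the middle word. -/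
theorem RelDecomp.occurrence (hC : WeaklyC R 4) (h₁ : RelDecomp R X₁ Y₁ Z₁)
    (h₂ : RelDecomp R X₂ Y₂ Z₂) {a c d : List A}
    (h : X₁ ++ (Y₁ ++ c) = a ++ (X₂ ++ (Y₂ ++ d))) :
    a = [] ∨ ∃ Y₀, Y₀ ≠ [] ∧ a = X₁ ++ Y₀ ∧ Y₁ ++ c = Y₀ ++ (X₂ ++ (Y₂ ++ d)) := by
  have aux : ∀ {e : List A}, X₁ = a ++ e → a = [] := by
    rintro e rfl
    have h' : (e ++ Y₁) ++ c = (X₂ ++ Y₂) ++ d := by simpa using h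
    rcases List.append_eq_append_iff.1 h' with ⟨f, hf, -⟩ | ⟨f, hf, -⟩
    · have := (h₁.eq_of_middle hC (a := e) (b := f ++ Z₂) (by
        have := h₂.1; rw [hf] at this; simpa using this)).1
      simpa using this
    · exact h₂.eq_nil_of_relWord hC (b := f ++ Z₁) (by
        have h0 := h₁.1
        have : a ++ e ++ Y₁ = a ++ (X₂ ++ Y₂ ++ f) := by rw [← hf]; simp
        rw [this] at h0; simpa using h0)
  rcases List.append_eq_append_iff.1 h with ⟨e, rfl, h'⟩ | ⟨e, he, -⟩
  · by_cases hn : e = []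
    · subst hn; exact Or.inl (aux (e := []) (by simp))
    · exact Or.inr ⟨e, hn, rfl, h'⟩
  · exact Or.inl (aux he)

end Decomp

/-! ### Words equivalent to one starting with a relation word -/

/-- `w` and `w'` become equivalent after left multiplication by some complement of `Z`. -/
def TailEquiv {A : Type*} (R : Finset (List A × List A)) (X Y Z w w' : List A) : Prop :=
  ∃ Zh, ZComp R X Y Z Zh ∧ MEquiv R (Zh ++ w) (Zh ++ w')

theorem relWord_of_relation {x y : List A} (h : (x, y) ∈ R ∨ (y, x) ∈ R) :
    RelWord R x ∧ RelWord R y := by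
  rcases h with h | h
  · exact ⟨⟨_, h, Or.inl rfl⟩, ⟨_, h, Or.inr rfl⟩⟩
  · exact ⟨⟨_, h, Or.inr rfl⟩, ⟨_, h, Or.inl rfl⟩⟩

theorem OneStep.of_relPrefix (hC : WeaklyC R 4) {X Y Z v' t : List A}
    (hd : RelDecomp R X Y Z) (h : OneStep R (X ++ Y ++ v') t) :
    (∃ w y, v' = Z ++ w ∧ t = y ++ w ∧ ((X ++ Y ++ Z, y) ∈ R ∨ (y, X ++ Y ++ Z) ∈ R)) ∨
    (∃ t', t = X ++ Y ++ t' ∧ OneStep R v' t') ∨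
    (∃ Y₀ Y₀' X₂ Y₂ Z₂ e, Y₀ ≠ [] ∧ Y₀' ≠ [] ∧ Y = Y₀ ++ Y₀' ∧ RelDecomp R X₂ Y₂ Z₂ ∧
      Y₀' ++ v' = X₂ ++ (Y₂ ++ (Z₂ ++ e))) := by
  obtain ⟨l, r, x, y, hxy, he, rfl⟩ := h
  obtain ⟨X₂, Y₂, Z₂, rfl, h₂⟩ := exists_relDecomp hC (relWord_of_relation hxy).1
  rcases hd.occurrence hC h₂ (a := l) (c := v') (d := Z₂ ++ r) (by simpa using he) with
    rfl | ⟨Y₀, hY₀, rfl, he'⟩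
  · left
    obtain ⟨rfl, rfl, rfl⟩ := hd.prefix_unique hC h₂ (c := v') (d := Z₂ ++ r)
      (by simpa using he)
    exact ⟨r, y, by simpa using he, by simp, hxy⟩
  · right
    rcases List.append_eq_append_iff.1 he' with ⟨c, rfl, rfl⟩ | ⟨c, rfl, hc⟩
    · left
      exact ⟨c ++ y ++ r, by simp, c, r, _, y, hxy, by simp, rfl⟩
    · by_cases hcn : c = []
      · subst hcn
        left
        refine ⟨y ++ r, by simp, [], r, _, y, hxy, ?_, by simp⟩
        simpa using hc.symm
      · right
        exact ⟨Y₀, c, X₂, Y₂, Z₂, r, hY₀, hcn, rfl, h₂, hc.symm⟩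

/-- Inside a middle word no relation prefix can start if the word continues with the
maximal piece suffix. -/
theorem RelDecomp.not_overlap_of_suffix (hC : WeaklyC R 4)
    {X Y₀ Y₀' Z X₂ Y₂ Z₂ w e : List A} (h : RelDecomp R X (Y₀ ++ Y₀') Z)
    (h₀ : Y₀ ≠ []) (h₀' : Y₀' ≠ []) (h₂ : RelDecomp R X₂ Y₂ Z₂)
    (he : Y₀' ++ (Z ++ w) = X₂ ++ (Y₂ ++ (Z₂ ++ e))) : False := by
  have he' : (Y₀' ++ Z) ++ w = (X₂ ++ Y₂ ++ Z₂) ++ e := by simpa using he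
  rcases List.append_eq_append_iff.1 he' with ⟨f, hf, -⟩ | ⟨f, hf, -⟩
  · have hp : Piece R (Y₀' ++ Z) := Or.inr ⟨_, _, X ++ Y₀, [], [], f, h.1, h₂.1, by simp,
      by simpa using hf, Or.inr (by simp [h₀])⟩
    have := h.2.2.2.2 _ ⟨X ++ Y₀, by simp⟩ hp
    simp [h₀'] at this
  · have := h₂.eq_nil_of_relWord hC (a := X ++ Y₀) (b := Z₂ ++ f) (by
      have h0 := h.1
      have : X ++ (Y₀ ++ Y₀') ++ Z = X ++ Y₀ ++ (Y₀' ++ Z) := by simp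
      rw [this, hf] at h0; simpa using h0)
    simp [h₀] at this

/-- Inside a middle word no relation prefix can start if the word continues with a prefix
of the maximal piece suffix and then another relation prefix. -/
theorem RelDecomp.not_overlap_of_relPrefix (hC : WeaklyC R 4)
    {X Y₀ Y₀' a p X₁ Y₁ Z₁ X₂ Y₂ Z₂ w e : List A} (h : RelDecomp R X (Y₀ ++ Y₀') (a ++ p))
    (h₀ : Y₀ ≠ []) (h₀' : Y₀' ≠ []) (h₁ : RelDecomp R X₁ Y₁ Z₁) (h₂ : RelDecomp R X₂ Y₂ Z₂)
    (he : Y₀' ++ (a ++ (X₁ ++ (Y₁ ++ w))) = X₂ ++ (Y₂ ++ (Z₂ ++ e))) : False := by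
  have he' : (Y₀' ++ a) ++ (X₁ ++ (Y₁ ++ w)) = (X₂ ++ Y₂) ++ (Z₂ ++ e) := by simpa using he
  rcases List.append_eq_append_iff.1 he' with ⟨m, hm, hm'⟩ | ⟨f, hf, -⟩
  · have hw : X₂ ++ Y₂ ++ Z₂ = Y₀' ++ a ++ (m ++ Z₂) := by rw [hm]; simp
    rw [← List.append_assoc] at hm'
    rcases List.append_eq_append_iff.1 hm' with ⟨f, rfl, -⟩ | ⟨f, hf, -⟩
    · have := h₁.eq_nil_of_relWord hC (a := Y₀' ++ a) (b := f ++ Z₂) (by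
        have h0 := h₂.1
        rw [hw] at h0; simpa using h0)
      simp [h₀'] at this
    · have hmp : Piece R m := Or.inr ⟨_, _, [], f ++ Z₁, Y₀' ++ a, Z₂, h₁.1, h₂.1,
        by rw [hf]; simp, by rw [hw]; simp, Or.inr (by simp [h₀'])⟩
      have hap : Piece R (Y₀' ++ a) := Or.inr ⟨_, _, [], m ++ Z₂, X ++ Y₀, p, h₂.1, h.1,
        by rw [hw]; simp, by simp, Or.inr (by simp [h₀])⟩
      have := hC _ h₂.1 [Y₀' ++ a, m, Z₂] (by
        intro q hq
        simp only [List.mem_cons, List.not_mem_nil, or_false] at hq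
        rcases hq with rfl | rfl | rfl
        exacts [hap, hmp, h₂.2.2.2.1]) (by rw [hw]; simp)
      simp at this
  · have := h₂.eq_nil_of_relWord hC (a := X ++ Y₀) (b := f ++ p) (by
      have h0 := h.1
      have : X ++ (Y₀ ++ Y₀') ++ (a ++ p) = X ++ Y₀ ++ ((Y₀' ++ a) ++ p) := by simp
      rw [this, hf] at h0; simpa using h0)
    simp [h₀] at this

theorem NStep.of_relWord_append (hC : WeaklyC R 4) (n : ℕ) {X Y Z w v : List A}
    (hd : RelDecomp R X Y Z) (h : NStep R n (X ++ Y ++ Z ++ w) v) :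
    ∃ X' Y' Z' v' w' m, RelComplement R (X ++ Y ++ Z) (X' ++ Y' ++ Z') ∧
      RelDecomp R X' Y' Z' ∧ v = X' ++ Y' ++ v' ∧ m ≤ n ∧ NStep R m (Z' ++ w') v' ∧
      Relation.ReflTransGen (TailEquiv R X Y Z) w w' := by
  induction n using Nat.strong_induction_on generalizing X Y Z w v with
  | _ n ih =>
  rcases n with _ | n
  · cases h
    exact ⟨X, Y, Z, Z ++ w, w, 0, ⟨hd.1, .refl⟩, hd, by simp, le_rfl, rfl, .refl⟩
  · obtain ⟨v₁, h₁, hs⟩ := h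
    obtain ⟨X', Y', Z', v', w', m, hc, hd', rfl, hm, hz, ht⟩ := ih n (by omega) hd h₁
    rcases hs.of_relPrefix hC hd' with ⟨w₁, y, rfl, rfl, hy⟩ | ⟨t', rfl, hs'⟩ |
      ⟨Y₀, Y₀', X₂, Y₂, Z₂, e, h₀, h₀', rfl, h₂, he⟩
    · obtain ⟨X₂, Y₂, Z₂, rfl, h₂⟩ := exists_relDecomp hC (relWord_of_relation hy).2
      exact ⟨X₂, Y₂, Z₂, Z₂ ++ w₁, w₁, 0, ⟨hc.1, hc.2.tail hy⟩, h₂, by simp, by omega, rfl,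
        ht.tail ⟨Z', ⟨X', Y', hc, hd'⟩, hz.mequiv⟩⟩
    · exact ⟨X', Y', Z', t', w', m + 1, hc, hd', rfl, by omega, ⟨_, hz, hs'⟩, ht⟩
    · exfalso
      obtain ⟨a, s', t', ha, rfl, ⟨hl, -⟩ | ⟨hl, r, f, i, j, hr, -, hj, -, h'⟩⟩ :=
        hz.split Z'.length (by simp)
      · obtain ⟨rfl, -⟩ := List.append_inj ha hl.symm
        exact hd'.not_overlap_of_suffix hC h₀ h₀' h₂ he
      · obtain ⟨X₁, Y₁, Z₁, rfl, hd₁⟩ := exists_relDecomp hC hr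
        obtain ⟨X₃, Y₃, Z₃, t, -, -, -, hd₃, rfl, -⟩ := ih j (by omega) hd₁ h'
        rcases List.append_eq_append_iff.1 ha with ⟨p, rfl, -⟩ | ⟨p, rfl, -⟩
        · simp at hl
        · exact hd'.not_overlap_of_relPrefix hC h₀ h₀' hd₃ h₂ (by simpa using he)

/-- `p ++ w` has a relation prefix `X ++ Y` at its start, with `p` a nonempty prefix of
`X`. -/
def ActiveAt {A : Type*} (R : Finset (List A × List A)) (p w : List A) : Prop :=
  p ≠ [] ∧ ∃ s Y Z c, RelDecomp R (p ++ s) Y Z ∧ w = s ++ (Y ++ c)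

theorem ActiveAt.unique (hC : WeaklyC R 4) {p q w : List A} (hp : ActiveAt R p w)
    (hq : ActiveAt R q w) : p = q := by
  obtain ⟨-, s, Y₁, Z₁, c, h₁, rfl⟩ := hp
  obtain ⟨-, t, Y₂, Z₂, d, h₂, h⟩ := hq
  exact (h₁.overlap_unique hC h₂ h).1

/-- How a word equivalent to one starting with a piece `Z` looks like. -/
theorem MEquiv.of_piece_append (hC : WeaklyC R 4) {Z w v : List A} (hZ : Piece R Z)
    (h : MEquiv R (Z ++ w) v) :
    (∃ w', v = Z ++ w' ∧ MEquiv R w w') ∨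
      ∃ a p v', Z = a ++ p ∧ ActiveAt R p w ∧ v = a ++ v' ∧ MEquiv R (p ++ w) v' := by
  obtain ⟨n, h⟩ := h.exists_nStep
  obtain ⟨a, s', t', ha, rfl, ⟨hl, h'⟩ | ⟨hl, r, f, i, j, hr, -, -, h₁, h₂⟩⟩ :=
    h.split Z.length (by simp)
  · obtain ⟨rfl, rfl⟩ := List.append_inj ha hl.symm
    exact Or.inl ⟨t', rfl, h'.mequiv⟩
  · right
    rcases List.append_eq_append_iff.1 ha with ⟨p, rfl, -⟩ | ⟨p, rfl, rfl⟩
    · simp at hl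
    obtain ⟨X₁, Y₁, Z₁, rfl, hd₁⟩ := exists_relDecomp hC hr
    obtain ⟨k, h₃⟩ := h₁.mequiv.symm.exists_nStep
    obtain ⟨X, Y, Z', t, -, -, -, hd, he, -⟩ := h₃.of_relWord_append hC k hd₁
    refine ⟨a, p, t', rfl, ⟨by rintro rfl; simp at hl, ?_⟩, rfl, h₁.mequiv.trans h₂.mequiv⟩
    have hp : Piece R p := hZ.of_factor ⟨a, [], by simp⟩
    rcases List.append_eq_append_iff.1 (he.trans (List.append_assoc _ _ _)) with
      ⟨s, rfl, rfl⟩ | ⟨s, rfl, hs⟩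
    · exact ⟨s, Y, Z', t, hd, rfl⟩
    · rcases List.append_eq_append_iff.1 hs with ⟨c, rfl, -⟩ | ⟨c, rfl, rfl⟩
      · exact absurd (hp.of_factor ⟨X, c, by simp⟩) (hd.middle_not_piece hC)
      · have := hd.2.1.2.2 (X ++ s) ⟨c ++ Z', by simp⟩ hp
        have hs0 : s = [] := by simpa using this
        subst hs0
        exact ⟨[], c, Z', t, by simpa using hd, by simp⟩

section Tail

variable {X Y Z w w' w'' : List A}

theorem ZComp.piece {Zh : List A} (h : ZComp R X Y Z Zh) : Piece R Zh := by
  obtain ⟨_, _, -, h⟩ := h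
  exact h.2.2.2.1

theorem RelDecomp.zComp_self (h : RelDecomp R X Y Z) : ZComp R X Y Z Z :=
  ⟨X, Y, ⟨h.1, .refl⟩, h⟩

theorem TailEquiv.symm (h : TailEquiv R X Y Z w w') : TailEquiv R X Y Z w' w := by
  obtain ⟨Zh, h, h'⟩ := h
  exact ⟨Zh, h, h'.symm⟩

theorem TailEquiv.cases (hC : WeaklyC R 4) (h : TailEquiv R X Y Z w w') :
    MEquiv R w w' ∨ ∃ a p, ZComp R X Y Z (a ++ p) ∧ ActiveAt R p w ∧
      MEquiv R (p ++ w) (p ++ w') := by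
  obtain ⟨Zh, h, h'⟩ := h
  rcases h'.of_piece_append hC h.piece with ⟨t, ht, h''⟩ | ⟨a, p, t, rfl, hp, ht, h''⟩
  · left
    obtain rfl : w' = t := by simpa using ht
    exact h''
  · right
    obtain rfl : p ++ w' = t := by simpa using ht
    exact ⟨a, p, h, hp, h''⟩

theorem TailEquiv.trans (hC : WeaklyC R 4) (h : TailEquiv R X Y Z w w')
    (h' : TailEquiv R X Y Z w' w'') : TailEquiv R X Y Z w w'' := by
  rcases h.symm.cases hC with e | ⟨a, p, hz, hp, e⟩
  · obtain ⟨Zh, hz, e'⟩ := h'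
    exact ⟨Zh, hz, (e.symm.append_left Zh).trans e'⟩
  · rcases h'.cases hC with e' | ⟨b, q, -, hq, e'⟩
    · obtain ⟨Zh, hz, e⟩ := h
      exact ⟨Zh, hz, e.trans (e'.append_left Zh)⟩
    · obtain rfl := hp.unique hC hq
      refine ⟨a ++ p, hz, ?_⟩
      have := (e.symm.trans e').append_left a
      simpa using this

theorem TailEquiv.of_reflTransGen (hC : WeaklyC R 4) (hd : RelDecomp R X Y Z)
    (h : Relation.ReflTransGen (TailEquiv R X Y Z) w w') : TailEquiv R X Y Z w w' := by
  induction h with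
  | refl => exact ⟨Z, hd.zComp_self, MEquiv.refl _⟩
  | tail _ h ih => exact ih.trans hC h

theorem TailEquiv.mequiv_of_not_prefixed (hC : WeaklyC R 4) (h : TailEquiv R X Y Z w w')
    {Zh u : List A} (hp : Piece R Zh) (hu : MEquiv R u (Zh ++ w)) (hn : ¬ Zh <+: u) :
    MEquiv R u (Zh ++ w') := by
  refine hu.trans ?_
  rcases hu.symm.of_piece_append hC hp with ⟨t, rfl, -⟩ | ⟨a, p, t, rfl, ha, -, -⟩
  · exact absurd ⟨t, rfl⟩ hn
  · rcases h.cases hC with e | ⟨b, q, -, hb, e⟩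
    · exact e.append_left _
    · obtain rfl := ha.unique hC hb
      simpa using e.append_left a

end Tail

theorem RelComplement.symm {r r' : List A} (h : RelComplement R r r') :
    RelComplement R r' r := by
  obtain ⟨hr, h⟩ := h
  induction h with
  | refl => exact ⟨hr, .refl⟩
  | tail _ h ih => exact ⟨(relWord_of_relation h).2, ih.2.head h.symm⟩

theorem RelComplement.trans {r r' r'' : List A} (h : RelComplement R r r')
    (h' : RelComplement R r' r'') : RelComplement R r r'' :=
  ⟨h.1, h.2.trans h'.2⟩

theorem RelComplement.mequiv {r r' : List A} (h : RelComplement R r r') :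
    MEquiv R r r' := by
  obtain ⟨-, h⟩ := h
  induction h with
  | refl => exact MEquiv.refl _
  | tail _ h ih => exact ih.tail ⟨[], [], _, _, h, by simp, by simp⟩

theorem TailEquiv.of_relComplement {X Y Z X' Y' Z' w w' : List A}
    (h : TailEquiv R X Y Z w w')
    (hc : RelComplement R (X' ++ Y' ++ Z') (X ++ Y ++ Z)) : TailEquiv R X' Y' Z' w w' := by
  obtain ⟨Zh, ⟨X₁, Y₁, h₁, h₂⟩, h₃⟩ := h
  exact ⟨Zh, ⟨X₁, Y₁, hc.trans h₁, h₂⟩, h₃⟩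

/-- The structure of words equivalent to a word starting with a relation word. -/
theorem MEquiv.of_relWord_append (hC : WeaklyC R 4) {X Y Z w v : List A}
    (hd : RelDecomp R X Y Z) (h : MEquiv R (X ++ Y ++ Z ++ w) v) :
    ∃ X' Y' Z' v' w', RelComplement R (X ++ Y ++ Z) (X' ++ Y' ++ Z') ∧
      RelDecomp R X' Y' Z' ∧ v = X' ++ Y' ++ v' ∧ MEquiv R v' (Z' ++ w') ∧
      TailEquiv R X Y Z w w' := by
  obtain ⟨n, h⟩ := h.exists_nStep
  obtain ⟨X', Y', Z', v', w', m, hc, hd', hv, -, hz, ht⟩ := h.of_relWord_append hC n hd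
  exact ⟨X', Y', Z', v', w', hc, hd', hv, hz.mequiv.symm, .of_reflTransGen hC hd ht⟩

section Main

variable {X Y Z u' v : List A}

theorem ProperComp.uniqueComp (hC : WeaklyC R 4) {r X' Y' Z' v' : List A}
    (h : ProperComp R r X' Y' Z') : UniqueComp R r (X' ++ Y' ++ v') X' Y' Z' := by
  rintro X₂ Y₂ Z₂ h₂ ⟨t, ht⟩
  exact h₂.2.1.prefix_unique hC h.2.1 (c := t) (d := v') (by simpa using ht)

theorem ProperComp.no_common_start (hC : WeaklyC R 4) (hd : RelDecomp R X Y Z)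
    {X' Y' Z' s t : List A} (h : ProperComp R (X ++ Y ++ Z) X' Y' Z')
    (he : X ++ (Y ++ s) = X' ++ (Y' ++ t)) : False := by
  obtain ⟨rfl, rfl, rfl⟩ := hd.prefix_unique hC h.2.1 he
  exact h.2.2 rfl

/-- Swapping a relation word for a complement in front of two tails. -/
theorem RelComplement.mequiv_append {X' Y' Z' s : List A}
    (h : RelComplement R (X ++ Y ++ Z) (X' ++ Y' ++ Z')) :
    MEquiv R (X ++ (Y ++ (Z ++ s))) (X' ++ (Y' ++ (Z' ++ s))) := by
  simpa using h.mequiv.append_right s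

theorem ZComp.mequiv_append {Zh s t : List A} (hz : ZComp R X Y Z Zh)
    (h : MEquiv R (Zh ++ s) (Zh ++ t)) :
    MEquiv R (X ++ (Y ++ (Z ++ s))) (X ++ (Y ++ (Z ++ t))) := by
  obtain ⟨X₁, Y₁, hc, -⟩ := hz
  exact hc.mequiv_append.trans (((h.append_left Y₁).append_left X₁).trans
    hc.mequiv_append.symm)

theorem mequiv_of_cond
    (h : Cond1 R X Y Z u' v ∨ Cond2 R X Y Z u' v ∨ Cond3 R X Y Z u' v ∨
      Cond4 R X Y Z u' v ∨ Cond5 R X Y Z u' v ∨ Cond6 R X Y Z u' v) :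
    MEquiv R (X ++ (Y ++ u')) v := by
  rcases h with ⟨u₁, v₁, rfl, rfl, Zh, hz, h⟩ | ⟨v₁, rfl, -, h⟩ |
    ⟨X', Y', Z', u₁, v₁, rfl, hp, rfl, -, Zh, hz, h⟩ | ⟨X', Y', Z', v₁, hp, rfl, -, -, h⟩ |
    ⟨X', Y', Z', u₁, v₁, rfl, hp, rfl, -, -, h⟩ |
    ⟨X', Y', Z', v₁, hp, rfl, -, -, -, z, z₁, z₂, u₂, v₂, rfl, rfl, -, rfl, rfl, h, -, w, hw⟩
  · simpa using hz.mequiv_append h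
  · simpa using (h.append_left Y).append_left X
  · simpa using (hz.mequiv_append h).trans hp.1.mequiv_append
  · simpa using ((h.append_left Y).append_left X).trans hp.1.mequiv_append
  · simpa using (hp.1.mequiv_append (s := u₁)).trans ((h.append_left Y').append_left X')
  · have h₁ := (hw.symm.append_left (X ++ Y ++ z₁))
    have h₂ := hp.1.mequiv_append (s := w)
    have h₃ := ((hw.trans h).append_left (X' ++ Y' ++ z₂))
    simp only [List.append_assoc] at h₁ h₂ h₃ ⊢
    exact h₁.trans (h₂.trans h₃)

theorem cond_of_relWord_front (hC : WeaklyC R 4) (hd : RelDecomp R X Y Z) {r e : List A}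
    (hr : RelWord R r) (hu : MEquiv R (r ++ e) (X ++ (Y ++ u')))
    (hv : MEquiv R (r ++ e) v) :
    Cond1 R X Y Z u' v ∨ Cond2 R X Y Z u' v ∨ Cond3 R X Y Z u' v ∨
      Cond4 R X Y Z u' v ∨ Cond5 R X Y Z u' v ∨ Cond6 R X Y Z u' v := by
  obtain ⟨X₀, Y₀, Z₀, rfl, hd₀⟩ := exists_relDecomp hC hr
  obtain ⟨X₁, Y₁, Z₁, u₁, w, hc₁, hd₁, he, hu₁, ht₁⟩ := hu.of_relWord_append hC hd₀
  obtain ⟨rfl, rfl, rfl⟩ := hd.prefix_unique hC hd₁ (c := u') (d := u₁) (by simpa using he)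
  obtain rfl : u' = u₁ := by simpa using he
  obtain ⟨X', Y', Z', v', w', hc', hd', rfl, hv', ht'⟩ := hv.of_relWord_append hC hd₀
  have ht : TailEquiv R X Y Z w w' := (ht₁.symm.trans hC ht').of_relComplement hc₁.symm
  have hc := hc₁.symm.trans hc'
  have hzc : ZComp R X Y Z Z' := ⟨X', Y', hc, hd'⟩
  have hpre : ∀ {u₂}, u' = Z ++ u₂ → TailEquiv R X Y Z u₂ w :=
    fun h => ⟨Z, hd.zComp_self, h ▸ hu₁⟩
  have hpre' : ∀ {v₂}, v' = Z' ++ v₂ → TailEquiv R X Y Z w' v₂ :=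
    fun h => ⟨Z', hzc, (h ▸ hv').symm⟩
  by_cases heq : X' ++ Y' ++ Z' = X ++ Y ++ Z
  · obtain ⟨rfl, rfl, rfl⟩ := hd'.unique hd heq
    by_cases h₁ : Z' <+: u'
    · obtain ⟨u₂, hu₂⟩ := h₁
      by_cases h₂ : Z' <+: v'
      · obtain ⟨v₂, hv₂⟩ := h₂
        left
        exact ⟨u₂, v₂, hu₂.symm, by simp [← hv₂],
          ((hpre hu₂.symm).trans hC ht).trans hC (hpre' hv₂.symm)⟩
      · right; left
        refine ⟨v', by simp, Or.inr h₂, ?_⟩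
        exact hu₁.trans (ht.symm.mequiv_of_not_prefixed hC hd.2.2.2.1 hv' h₂).symm
    · right; left
      exact ⟨v', by simp, Or.inl h₁,
        (ht.mequiv_of_not_prefixed hC hd.2.2.2.1 hu₁ h₁).trans hv'.symm⟩
  · have hprop : ProperComp R (X ++ Y ++ Z) X' Y' Z' := ⟨hc, hd', heq⟩
    have huniq := hprop.uniqueComp hC (v' := v')
    right; right
    by_cases h₁ : Z <+: u'
    · obtain ⟨u₂, hu₂⟩ := h₁
      by_cases h₂ : Z' <+: v'
      · obtain ⟨v₂, hv₂⟩ := h₂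
        left
        exact ⟨X', Y', Z', u₂, v₂, hu₂.symm, hprop, by simp [← hv₂], huniq,
          ((hpre hu₂.symm).trans hC ht).trans hC (hpre' hv₂.symm)⟩
      · right; right; left
        refine ⟨X', Y', Z', u₂, v', hu₂.symm, hprop, rfl, huniq, h₂, ?_⟩
        exact (((hpre hu₂.symm).trans hC ht).symm.mequiv_of_not_prefixed hC
          hd'.2.2.2.1 hv' h₂).symm
    · by_cases h₂ : Z' <+: v'
      · obtain ⟨v₂, hv₂⟩ := h₂
        right; left
        exact ⟨X', Y', Z', v₂, hprop, by simp [← hv₂], huniq, h₁,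
          (ht.trans hC (hpre' hv₂.symm)).mequiv_of_not_prefixed hC hd.2.2.2.1 hu₁ h₁⟩
      · right; right; right
        refine ⟨X', Y', Z', v', hprop, rfl, huniq, h₁, h₂, ?_⟩
        have hu₂ := ht.mequiv_of_not_prefixed hC hd.2.2.2.1 hu₁ h₁
        rcases hu₂.symm.of_piece_append hC hd.2.2.2.1 with
          ⟨t, rfl, -⟩ | ⟨a, p, s, hZ, ha, hus, hs⟩
        · exact absurd ⟨t, rfl⟩ h₁
        rcases hv'.symm.of_piece_append hC hd'.2.2.2.1 with
          ⟨t, rfl, -⟩ | ⟨b, q, t, hZ', hb, hvt, ht⟩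
        · exact absurd ⟨t, rfl⟩ h₂
        obtain rfl := ha.unique hC hb
        obtain ⟨z, z₁, z₂, hz₁, hz₂, hmax⟩ := exists_max_common_suffix Z Z'
        have hpZ : p <:+ Z := ⟨a, hZ.symm⟩
        obtain ⟨c, rfl⟩ := List.suffix_of_suffix_length_le hpZ ⟨z₁, hz₁.symm⟩
          (hmax p hpZ ⟨b, hZ'.symm⟩)
        obtain rfl : a = z₁ ++ c := by
          rw [hZ, ← List.append_assoc] at hz₁
          exact List.append_cancel_right hz₁
        obtain rfl : b = z₂ ++ c := by
          rw [hZ', ← List.append_assoc] at hz₂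
          exact List.append_cancel_right hz₂
        refine ⟨c ++ p, z₁, z₂, c ++ s, c ++ t, hz₁, hz₂, hmax, by simpa using hus,
          by simpa using hvt, (hs.symm.trans ht).append_left c, by simp [ha.1], w', ?_⟩
        simpa using hs.append_left c

theorem cond_of_mequiv (hC : WeaklyC R 4) (hd : RelDecomp R X Y Z)
    (hclean : CleanAt R (X ++ (Y ++ u')) [] X Y) (h : MEquiv R (X ++ (Y ++ u')) v) :
    Cond1 R X Y Z u' v ∨ Cond2 R X Y Z u' v ∨ Cond3 R X Y Z u' v ∨
      Cond4 R X Y Z u' v ∨ Cond5 R X Y Z u' v ∨ Cond6 R X Y Z u' v := by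
  by_cases hf : ∃ r e, RelWord R r ∧ MEquiv R (r ++ e) (X ++ (Y ++ u'))
  · obtain ⟨r, e, hr, he⟩ := hf
    exact cond_of_relWord_front hC hd hr he (he.trans h)
  · obtain ⟨n, hn⟩ := h.exists_nStep
    obtain ⟨a, s, t, ha, rfl, ⟨hl, h'⟩ | ⟨hl, r, f, i, j, hr, -, -, h₁, -⟩⟩ :=
      hn.split (X ++ Y).length (by simp)
    · rw [← List.append_assoc] at ha
      obtain ⟨rfl, rfl⟩ := List.append_inj ha hl.symm
      right; left
      refine ⟨t, rfl, Or.inl ?_, h'.mequiv⟩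
      rintro ⟨e, rfl⟩
      exact hf ⟨X ++ Y ++ Z, e, hd.1, by simpa using MEquiv.refl _⟩
    · exfalso
      obtain ⟨X₁, Y₁, Z₁, rfl, hd₁⟩ := exists_relDecomp hC hr
      obtain ⟨X₂, Y₂, Z₂, s', -, -, hd₂, rfl, -⟩ :=
        h₁.mequiv.symm.of_relWord_append hC hd₁
      rcases hd.occurrence hC hd₂ (c := u') (d := s') (by simpa using ha) with
        rfl | ⟨Y₀, hY₀, rfl, he⟩
      · rw [ha] at hf
        exact hf ⟨_, f, hr, h₁.mequiv.symm⟩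
      · rcases List.append_eq_append_iff.1 he with ⟨c, rfl, -⟩ | ⟨c, rfl, -⟩
        · simp at hl
        · refine hclean ⟨Y₀, X₂, Y₂, Z₂, hd₂, hY₀, ⟨c, rfl⟩, ?_, s', ?_⟩
          · intro hc
            rw [← hc] at hl
            simp at hl
          · simp only [List.append_assoc] at ha ⊢
            simpa using ha.symm

end Main

end Words

/-- Lemma 13: for a weakly `C(4)` finite monoid presentation, if
`u = X ++ Y ++ u'` with `X ++ Y` a clean overlap prefix of `u`, then `u ≡ v` if and
only if one of the mutually exclusive conditions (1)–(6) holds. -/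
theorem lemma_eq {A : Type*} [Fintype A] [DecidableEq A]
    (R : Finset (List A × List A)) (hC : WeaklyC R 4)
    (u u' X Y Z v : List A)
    (hu : u = X ++ Y ++ u')
    (hclean : CleanOverlapPrefix R u [] X Y Z) :
    (MEquiv R u v ↔
      (Cond1 R X Y Z u' v ∨ Cond2 R X Y Z u' v ∨ Cond3 R X Y Z u' v ∨
        Cond4 R X Y Z u' v ∨ Cond5 R X Y Z u' v ∨ Cond6 R X Y Z u' v)) ∧
    ¬ (Cond1 R X Y Z u' v ∧ Cond2 R X Y Z u' v) ∧
    ¬ (Cond1 R X Y Z u' v ∧ Cond3 R X Y Z u' v) ∧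
    ¬ (Cond1 R X Y Z u' v ∧ Cond4 R X Y Z u' v) ∧
    ¬ (Cond1 R X Y Z u' v ∧ Cond5 R X Y Z u' v) ∧
    ¬ (Cond1 R X Y Z u' v ∧ Cond6 R X Y Z u' v) ∧
    ¬ (Cond2 R X Y Z u' v ∧ Cond3 R X Y Z u' v) ∧
    ¬ (Cond2 R X Y Z u' v ∧ Cond4 R X Y Z u' v) ∧
    ¬ (Cond2 R X Y Z u' v ∧ Cond5 R X Y Z u' v) ∧
    ¬ (Cond2 R X Y Z u' v ∧ Cond6 R X Y Z u' v) ∧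
    ¬ (Cond3 R X Y Z u' v ∧ Cond4 R X Y Z u' v) ∧
    ¬ (Cond3 R X Y Z u' v ∧ Cond5 R X Y Z u' v) ∧
    ¬ (Cond3 R X Y Z u' v ∧ Cond6 R X Y Z u' v) ∧
    ¬ (Cond4 R X Y Z u' v ∧ Cond5 R X Y Z u' v) ∧
    ¬ (Cond4 R X Y Z u' v ∧ Cond6 R X Y Z u' v) ∧
    ¬ (Cond5 R X Y Z u' v ∧ Cond6 R X Y Z u' v) := by
  subst hu
  obtain ⟨hd, -, hcl⟩ := hclean
  have hdisj : ∀ {X' Y' Z' s t}, ProperComp R (X ++ Y ++ Z) X' Y' Z' →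
      X ++ Y ++ s = X' ++ Y' ++ t → False := fun hp he =>
    hp.no_common_start hC hd (by simpa using he)
  have hsame : ∀ {X₁ Y₁ Z₁ X₂ Y₂ Z₂ s t : List A}, RelDecomp R X₁ Y₁ Z₁ →
      RelDecomp R X₂ Y₂ Z₂ → v = X₁ ++ Y₁ ++ Z₁ ++ s → v = X₂ ++ Y₂ ++ t →
      Z₂ <+: t := by
    rintro X₁ Y₁ Z₁ X₂ Y₂ Z₂ s t h₁ h₂ hv hv'
    have he := hv.symm.trans hv'
    obtain ⟨rfl, rfl, rfl⟩ := h₁.prefix_unique hC h₂ (c := Z₁ ++ s) (d := t)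
      (by simpa using he)
    exact ⟨s, by simpa using he⟩
  refine ⟨⟨fun h => ?_, fun h => ?_⟩, ?_, ?_, ?_, ?_, ?_, ?_, ?_, ?_, ?_, ?_, ?_, ?_, ?_, ?_, ?_⟩
  · simp only [List.append_assoc] at h hcl
    exact cond_of_mequiv hC hd hcl h
  · simpa using mequiv_of_cond h
  · rintro ⟨⟨s, t, hs, hv, -⟩, ⟨t', hv', hn, -⟩⟩
    exact hn.elim (fun h => h ⟨s, hs.symm⟩) (fun h => h (hsame hd hd hv hv'))
  · rintro ⟨⟨s, t, -, hv, -⟩, ⟨X', Y', Z', s', t', -, hp, hv', -⟩⟩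
    exact hdisj hp (s := Z ++ t) (t := Z' ++ t') (by simpa using hv.symm.trans hv')
  · rintro ⟨⟨s, t, hs, -⟩, ⟨X', Y', Z', t', -, -, -, hn, -⟩⟩
    exact hn ⟨s, hs.symm⟩
  · rintro ⟨⟨s, t, -, hv, -⟩, ⟨X', Y', Z', s', t', -, hp, hv', -⟩⟩
    exact hdisj hp (s := Z ++ t) (t := t') (by simpa using hv.symm.trans hv')
  · rintro ⟨⟨s, t, hs, -⟩, ⟨X', Y', Z', t', -, -, -, hn, -⟩⟩
    exact hn ⟨s, hs.symm⟩
  · rintro ⟨⟨t, hv, -⟩, ⟨X', Y', Z', s', t', -, hp, hv', -⟩⟩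
    exact hdisj hp (s := t) (t := Z' ++ t') (by simpa using hv.symm.trans hv')
  · rintro ⟨⟨t, hv, -⟩, ⟨X', Y', Z', t', hp, hv', -⟩⟩
    exact hdisj hp (s := t) (t := Z' ++ t') (by simpa using hv.symm.trans hv')
  · rintro ⟨⟨t, hv, -⟩, ⟨X', Y', Z', s', t', -, hp, hv', -⟩⟩
    exact hdisj hp (s := t) (t := t') (by simpa using hv.symm.trans hv')
  · rintro ⟨⟨t, hv, -⟩, ⟨X', Y', Z', t', hp, hv', -⟩⟩
    exact hdisj hp (s := t) (t := t') (by simpa using hv.symm.trans hv')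
  · rintro ⟨⟨_, _, _, s, t, hs, -⟩, ⟨X', Y', Z', t', -, -, -, hn, -⟩⟩
    exact hn ⟨s, hs.symm⟩
  · rintro ⟨⟨X₁, Y₁, Z₁, s, t, -, hp, hv, -⟩, ⟨X', Y', Z', s', t', -, hp', hv', -, hn, -⟩⟩
    exact hn (hsame hp.2.1 hp'.2.1 hv hv')
  · rintro ⟨⟨_, _, _, s, t, hs, -⟩, ⟨X', Y', Z', t', -, -, -, hn, -⟩⟩
    exact hn ⟨s, hs.symm⟩
  · rintro ⟨⟨_, _, _, _, -, -, -, hn, -⟩, ⟨_, _, _, s, _, hs, -⟩⟩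
    exact hn ⟨s, hs.symm⟩
  · rintro ⟨⟨X₁, Y₁, Z₁, t, hp, hv, -⟩, ⟨X', Y', Z', t', hp', hv', -, -, hn, -⟩⟩
    exact hn (hsame hp.2.1 hp'.2.1 hv hv')
  · rintro ⟨⟨_, _, _, s, _, hs, -⟩, ⟨X', Y', Z', t', -, -, -, hn, -⟩⟩
    exact hn ⟨s, hs.symm⟩
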